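/- arXiv:2104.09451 — 4 statements merged into one kernel-verified Lean document; each statement's English description precedes it below -/
import Mathlib

section
/- Let P be the path graph on n ≥ 1 vertices and let v be any vertex of P. Then there exists a playable nonadaptive strategy S = (d_1, …, d_{n−1}) of length n−1 such that every play x_0 = v, x_1, …, x_{n−1} consistent with S consists of n pairwise distinct vertices; hence, regardless of the Director's choices, the token visits each vertex of P exactly once. -/
open SimpleGraph

variable {V : Type*}

/-- The eccentricity of a vertex: the maximum graph distance to any vertex. -/
noncomputable def ecc [Fintype V] (G : SimpleGraph V) (u : V) : ℕ :=
  Finset.univ.sup fun w => G.dist u w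

/-- The diameter of a graph: the maximum eccentricity. -/
noncomputable def graphDiam [Fintype V] (G : SimpleGraph V) : ℕ :=
  Finset.univ.sup fun u => ecc G u

/-- A nonempty set `U` of vertices is closed if for every `u ∈ U` and every vertex `v`
there is `x ∈ U` with `dist u v = dist u x`. -/
def IsClosedSet (G : SimpleGraph V) (U : Set V) : Prop :=
  U.Nonempty ∧ ∀ u ∈ U, ∀ v : V, ∃ x ∈ U, G.dist u v = G.dist u x

/-- An Explorer strategy (assigning a called distance to each history, most recent
vertex first) is valid if, whenever the current vertex `u` has a legal call available
(`1 ≤ ecc u`), it calls some `k` with `1 ≤ k ≤ ecc u`. -/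
def EValid [Fintype V] (G : SimpleGraph V) (ES : List V → ℕ) : Prop :=
  ∀ h : List V, ∀ u : V, h.head? = some u → 1 ≤ ecc G u →
    1 ≤ ES h ∧ ES h ≤ ecc G u

/-- A Director strategy is valid if, for each history with current vertex `u` and each
legal called distance `k` (`1 ≤ k ≤ ecc u`), it answers a vertex at distance exactly `k`. -/
def DValid [Fintype V] (G : SimpleGraph V) (DS : List V → ℕ → V) : Prop :=
  ∀ h : List V, ∀ u : V, h.head? = some u → ∀ k : ℕ, 1 ≤ k → k ≤ ecc G u →
    G.dist u (DS h k) = k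

/-- The history (most recent vertex first) of the first `n` moves of the play determined
by Explorer strategy `ES` and Director strategy `DS`, starting at `v`. -/
def play (ES : List V → ℕ) (DS : List V → ℕ → V) (v : V) : ℕ → List V
  | 0 => [v]
  | n + 1 => DS (play ES DS v n) (ES (play ES DS v n)) :: play ES DS v n

/-- The number of distinct vertices visited in the play determined by `ES` and `DS`
starting at `v`. -/
noncomputable def playScore (ES : List V → ℕ) (DS : List V → ℕ → V) (v : V) : ℕ :=
  Set.ncard {x : V | ∃ n : ℕ, x ∈ play ES DS v n}

/-- `fd G v` : the max over valid Explorer strategies of the min over valid Director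
strategies of the number of distinct vertices visited. -/
noncomputable def fd [Fintype V] (G : SimpleGraph V) (v : V) : ℕ :=
  sSup {r : ℕ | ∃ ES : List V → ℕ, EValid G ES ∧
    r = sInf {s : ℕ | ∃ DS : List V → ℕ → V, DValid G DS ∧ s = playScore ES DS v}}

/-- A play `x` is consistent with the nonadaptive strategy `S` from start `v` if it starts
at `v` and each step has the prescribed length. -/
def NAConsistent (G : SimpleGraph V) (S : List ℕ) (v : V) (x : ℕ → V) : Prop :=
  x 0 = v ∧ ∀ i < S.length, G.dist (x i) (x (i + 1)) = S.getD i 0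

/-- A nonadaptive strategy is playable from `v` if every consistent initial segment
can be extended. -/
def NAPlayable (G : SimpleGraph V) (S : List ℕ) (v : V) : Prop :=
  ∀ x : ℕ → V, ∀ i < S.length, x 0 = v →
    (∀ j < i, G.dist (x j) (x (j + 1)) = S.getD j 0) →
    ∃ y : V, G.dist (x i) y = S.getD i 0

/-- The score of a nonadaptive strategy `S` from `v`: the minimum over consistent plays
of the number of distinct vertices among `x 0, …, x S.length`. -/
noncomputable def naScore (G : SimpleGraph V) (S : List ℕ) (v : V) : ℕ :=
  sInf {k : ℕ | ∃ x : ℕ → V, NAConsistent G S v x ∧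
    k = Set.ncard {w : V | ∃ i ≤ S.length, x i = w}}

/-- The `n × m` grid graph: the box product of two path graphs. -/
def gridGraph (n m : ℕ) : SimpleGraph (Fin n × Fin m) :=
  (pathGraph n) □ (pathGraph m)

theorem SimpleGraph.pathGraph_dist_add_le {n : ℕ} (u : Fin n) (k : ℕ) (h : u.val + k < n) :
    (pathGraph n).dist u ⟨u.val + k, h⟩ ≤ k := by
  induction k with
  | zero => simp
  | succ k ih =>
    have hadj : (pathGraph n).Adj ⟨u.val + k, by omega⟩ ⟨u.val + (k + 1), h⟩ :=
      pathGraph_adj.2 (Or.inl (by simp; omega))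
    have htri := (pathGraph_preconnected n u ⟨u.val + k, by omega⟩).dist_triangle_left
      ⟨u.val + (k + 1), h⟩
    have hone := dist_eq_one_iff_adj.2 hadj
    have := ih (by omega)
    omega

theorem SimpleGraph.pathGraph_natDist_le_length {n : ℕ} {u v : Fin n}
    (w : (pathGraph n).Walk u v) : Nat.dist u v ≤ w.length := by
  induction w with
  | nil => simp
  | cons h w ih =>
    rw [pathGraph_adj] at h
    simp only [Nat.dist, Walk.length_cons] at *
    omega

theorem SimpleGraph.pathGraph_dist {n : ℕ} (u v : Fin n) :
    (pathGraph n).dist u v = Nat.dist u v := by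
  apply le_antisymm
  · wlog huv : u ≤ v generalizing u v
    · rw [dist_comm, Nat.dist_comm]
      exact this v u (le_of_not_ge huv)
    have huv' : u.val ≤ v.val := huv
    have := pathGraph_dist_add_le u (v.val - u.val) (by omega)
    simp only [Nat.add_sub_cancel' huv'] at this
    rwa [Nat.dist_eq_sub_of_le huv']
  · obtain ⟨w, hw⟩ := (pathGraph_preconnected n u v).exists_walk_length_eq_dist
    exact hw ▸ pathGraph_natDist_le_length w

/-- A Hamiltonian ordering of `{0, …, n - 1}` in which the reflection of each entry through the
preceding one falls outside `{0, …, n - 1}`, except possibly at the first step when the ordering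
starts at the midpoint. -/
structure IsForcingRoute (n : ℕ) (p : ℕ → ℕ) : Prop where
  lt : ∀ i < n, p i < n
  inj : ∀ i j, i < n → j < n → p i = p j → i = j
  forced : ∀ i, i + 1 < n → ∀ y < n, y + p (i + 1) = 2 * p i → i = 0 ∧ 2 * p 0 + 1 = n

namespace IsForcingRoute

variable {n : ℕ} {p : ℕ → ℕ}

/-- A sequence following the step lengths of a forcing route agrees with the route or with its
mirror image. -/
theorem eq_or_mirror (hp : IsForcingRoute n p) {x : ℕ → Fin n}
    (h0 : (x 0).val = p 0 ∨ (x 0).val + p 0 + 1 = n) {i : ℕ} (hi : i < n)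
    (hx : ∀ j < i, Nat.dist (x j) (x (j + 1)) = Nat.dist (p j) (p (j + 1))) :
    (∀ j ≤ i, (x j).val = p j) ∨ (∀ j ≤ i, (x j).val + p j + 1 = n) := by
  induction i with
  | zero => simpa using h0
  | succ i ih =>
    have hstep := hx i (by omega)
    have hy := (x (i + 1)).isLt
    have hpi := hp.lt i (by omega)
    have hpi' := hp.lt (i + 1) hi
    have hf := hp.forced i hi (x (i + 1)) hy
    have hf' := hp.forced i hi (n - 1 - x (i + 1)) (by omega)
    simp only [Nat.dist] at hstep
    have key : (∀ j ≤ i, (x j).val = p j) ∧ (x (i + 1)).val = p (i + 1) ∨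
        (∀ j ≤ i, (x j).val + p j + 1 = n) ∧ (x (i + 1)).val + p (i + 1) + 1 = n := by
      rcases ih (by omega) fun j hj => hx j (by omega) with h | h
      · have hxi := h i le_rfl
        by_cases hc : (x (i + 1)).val = p (i + 1)
        · exact Or.inl ⟨h, hc⟩
        · obtain ⟨rfl, hmid⟩ := hf (by omega)
          refine Or.inr ⟨fun j hj => ?_, by omega⟩
          obtain rfl : j = 0 := by omega
          omega
      · have hxi := h i le_rfl
        by_cases hc : (x (i + 1)).val + p (i + 1) + 1 = n
        · exact Or.inr ⟨h, hc⟩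
        · obtain ⟨rfl, hmid⟩ := hf' (by omega)
          refine Or.inl ⟨fun j hj => ?_, by omega⟩
          obtain rfl : j = 0 := by omega
          omega
    refine key.imp (fun ⟨h, h'⟩ j hj => ?_) fun ⟨h, h'⟩ j hj => ?_ <;>
    · rcases Nat.le_succ_iff.1 hj with hj | rfl
      · exact h j hj
      · exact h'

/-- The step lengths of a forcing route form a nonadaptive strategy that visits every vertex of
the path, from the start of the route and from its mirror image. -/
theorem exists_strategy (hp : IsForcingRoute n p) {v : Fin n}
    (hv : v.val = p 0 ∨ v.val + p 0 + 1 = n) :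
    ∃ S : List ℕ, S.length = n - 1 ∧ (∀ d ∈ S, 1 ≤ d) ∧
      NAPlayable (pathGraph n) S v ∧
      ∀ x : ℕ → Fin n, NAConsistent (pathGraph n) S v x →
        ∀ i j : ℕ, i ≤ n - 1 → j ≤ n - 1 → x i = x j → i = j := by
  have hn : 0 < n := v.pos
  set S := (List.range (n - 1)).map fun i => Nat.dist (p i) (p (i + 1)) with hS
  have hlen : S.length = n - 1 := by simp [hS]
  have hget : ∀ i < n - 1, S.getD i 0 = Nat.dist (p i) (p (i + 1)) := by
    intro i hi
    simp [hS, List.getD_eq_getElem?_getD, hi]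
  refine ⟨S, hlen, ?_, ?_, ?_⟩
  · intro d hd
    simp only [hS, List.mem_map, List.mem_range] at hd
    obtain ⟨i, hi, rfl⟩ := hd
    refine Nat.dist_pos_of_ne fun h => ?_
    have := hp.inj i (i + 1) (by omega) (by omega) h
    omega
  · intro x i hi h0 hx
    rw [hlen] at hi
    have hpi := hp.lt i (by omega)
    have hpi' := hp.lt (i + 1) (by omega)
    rw [hget i hi]
    rcases hp.eq_or_mirror (x := x) (i := i) (by rwa [h0]) (by omega) fun j hj => by
      rw [← pathGraph_dist, hx j hj, hget j (by omega)] with h | h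
    · refine ⟨⟨p (i + 1), hpi'⟩, ?_⟩
      rw [pathGraph_dist, h i le_rfl]
    · refine ⟨⟨n - 1 - p (i + 1), by omega⟩, ?_⟩
      have := h i le_rfl
      rw [pathGraph_dist]
      simp only [Nat.dist]
      omega
  · rintro x ⟨h0, hx⟩ i j hi hj hij
    have hij' : (x i).val = (x j).val := by rw [hij]
    refine hp.inj i j (by omega) (by omega) ?_
    rcases hp.eq_or_mirror (x := x) (i := n - 1) (by rwa [h0]) (by omega) fun j hj => by
      rw [← pathGraph_dist, hx j (by omega), hget j hj] with h | h
    · rw [← h i hi, ← h j hj, hij']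
    · have := h i hi
      have := h j hj
      omega

end IsForcingRoute

theorem exists_isForcingRoute_odd {m a : ℕ} (ha : a ≤ m) :
    ∃ p, IsForcingRoute (2 * m + 1) p ∧ p 0 = a := by
  refine ⟨fun i => if i % 2 = 0 then (if i / 2 ≤ a then a - i / 2 else i / 2)
    else (if i / 2 < a then m + a - i / 2 else m + 1 + i / 2), ⟨?_, ?_, ?_⟩, by simp⟩
  · intro i hi
    split_ifs <;> omega
  · intro i j hi hj h
    split_ifs at h <;> omega
  · intro i hi y hy h
    split_ifs at h ⊢ <;> omega

theorem exists_isForcingRoute_even {m a : ℕ} (ha : a < m) (ha0 : 0 < a) :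
    ∃ p, IsForcingRoute (2 * m) p ∧ p 0 = a := by
  refine ⟨fun i => if i % 2 = 0 then (if i / 2 + a < m then a + i / 2 else m - 1 - i / 2)
    else (if i / 2 + a < m then m + a + i / 2 else 2 * m - 1 - i / 2), ⟨?_, ?_, ?_⟩, by simp [ha]⟩
  · intro i hi
    split_ifs <;> omega
  · intro i j hi hj h
    split_ifs at h <;> omega
  · intro i hi y hy h
    split_ifs at h ⊢ <;> omega

theorem exists_isForcingRoute_even_zero {m : ℕ} (hm : 0 < m) :
    ∃ p, IsForcingRoute (2 * m) p ∧ p 0 = 0 := by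
  obtain rfl | rfl | hm3 : m = 1 ∨ m = 2 ∨ 3 ≤ m := by omega
  · exact ⟨id, ⟨fun i hi => hi, fun i j _ _ h => h, fun i hi y hy h => by simp at h; omega⟩, rfl⟩
  · refine ⟨fun i => [0, 1, 3, 2].getD i 0, ⟨?_, ?_, ?_⟩, rfl⟩
    · decide
    · intro i j hi hj
      interval_cases i <;> interval_cases j <;> simp
    · intro i hi y hy
      have : i < 3 := by omega
      interval_cases i <;> simp <;> omega
  · refine ⟨fun i => if i = 0 then 0 else if i = 1 then 2 * m - 2 else if i = 2 then m - 1 else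
      if i = 3 then 2 * m - 1 else if i % 2 = 0 then m - i / 2 else 2 * m - 1 - i / 2,
      ⟨?_, ?_, ?_⟩, by simp⟩
    · intro i hi
      split_ifs <;> omega
    · intro i j hi hj h
      split_ifs at h <;> omega
    · intro i hi y hy h
      exfalso
      split_ifs at h <;> omega

theorem exists_isForcingRoute {n a : ℕ} (ha : 2 * a < n) :
    ∃ p, IsForcingRoute n p ∧ p 0 = a := by
  obtain ⟨m, rfl | rfl⟩ := n.even_or_odd'
  · rcases Nat.eq_zero_or_pos a with rfl | ha0
    · exact exists_isForcingRoute_even_zero (by omega)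
    · exact exists_isForcingRoute_even (by omega) ha0
  · exact exists_isForcingRoute_odd (by omega)

/-- On the path graph with `n ≥ 1` vertices, from any start vertex `v` there
is a playable nonadaptive strategy of length `n - 1` such that every consistent play
`x_0 = v, x_1, …, x_{n-1}` consists of `n` pairwise distinct vertices. -/
theorem stmt_14 (n : ℕ) (hn : 1 ≤ n) (v : Fin n) :
    ∃ S : List ℕ, S.length = n - 1 ∧ (∀ d ∈ S, 1 ≤ d) ∧
      NAPlayable (pathGraph n) S v ∧
      ∀ x : ℕ → Fin n, NAConsistent (pathGraph n) S v x →
        ∀ i j : ℕ, i ≤ n - 1 → j ≤ n - 1 → x i = x j → i = j := by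
  rcases lt_or_ge (2 * v.val) n with h | h
  · obtain ⟨p, hp, hp0⟩ := exists_isForcingRoute h
    exact hp.exists_strategy (Or.inl hp0.symm)
  · obtain ⟨p, hp, hp0⟩ := exists_isForcingRoute (n := n) (a := n - 1 - v.val) (by omega)
    exact hp.exists_strategy (Or.inr (by omega))
end

section
/- Let T be the tree obtained from a path of length 4 with endpoints a and C by attaching at C two further paths of length 5 each (so T has 15 vertices and diam(T) = 10). Then f_d(T, a) = 15, yet there is no playable nonadaptive strategy S with f_d^S(T, a) = f_d(T, a); that is, the game on T started at a admits no optimal nonadaptive strategy. -/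
open SimpleGraph

variable {V : Type*}

/-- The spider tree: a path of length 4 with endpoints `a = 0` and `C = 4`, with two
further paths of length 5 attached at `C` (vertices `4,5,…,9` and `4,10,…,14`). -/
def spider : SimpleGraph (Fin 15) :=
  SimpleGraph.fromRel fun u v => ((u : ℕ), (v : ℕ)) ∈
    [(0,1),(1,2),(2,3),(3,4),(4,5),(5,6),(6,7),(7,8),(8,9),
     (4,10),(10,11),(11,12),(12,13),(13,14)]

section Nonadaptive

variable {G : SimpleGraph V} {S : List ℕ} {d : ℕ} {u y w : V}

/-- Some play consistent with `S` from `u` never visits `w`. -/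
def Avoids (G : SimpleGraph V) (S : List ℕ) (u w : V) : Prop :=
  ∃ x : ℕ → V, NAConsistent G S u x ∧ ∀ i ≤ S.length, x i ≠ w

theorem NAPlayable.exists_dist_eq (h : NAPlayable G (d :: S) u) : ∃ y, G.dist u y = d := by
  simpa using h (fun _ => u) 0 (by simp) rfl (by simp)

theorem NAPlayable.tail (h : NAPlayable G (d :: S) u) (hy : G.dist u y = d) :
    NAPlayable G S y := by
  intro x i hi hx hc
  have := h (fun n => Nat.casesOn n u x) (i + 1) (by simpa using hi) rfl (by
    rintro (_ | j) hj
    · simpa [hx] using hy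
    · simpa using hc j (by omega))
  simpa using this

theorem avoids_nil (h : u ≠ w) : Avoids G [] u w :=
  ⟨fun _ => u, ⟨rfl, by simp⟩, fun _ _ => h⟩

theorem Avoids.cons (h : Avoids G S y w) (hu : u ≠ w) (hy : G.dist u y = d) :
    Avoids G (d :: S) u w := by
  obtain ⟨x, ⟨hx, hc⟩, ha⟩ := h
  refine ⟨fun n => Nat.casesOn n u x, ⟨rfl, ?_⟩, ?_⟩
  · rintro (_ | i) hi
    · simpa [hx] using hy
    · simpa using hc i (by simpa using hi)
  · rintro (_ | i) hi
    · exact hu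
    · exact ha i (by simpa using hi)

theorem Avoids.naScore_lt [Fintype V] (h : Avoids G S u w) :
    naScore G S u < Fintype.card V := by
  obtain ⟨x, hx, ha⟩ := h
  have hle : naScore G S u ≤ _ := Nat.sInf_le ⟨x, hx, rfl⟩
  refine hle.trans_lt ?_
  rw [← Nat.card_eq_fintype_card, ← Set.ncard_univ]
  refine Set.ncard_lt_ncard ((Set.ssubset_univ_iff).2 fun he => ?_)
  obtain ⟨i, hi, hw⟩ := he.symm.subset (Set.mem_univ w)
  exact ha i hi hw

end Nonadaptive

section Games

variable {G : SimpleGraph V} {ES : List V → ℕ} {DS : List V → ℕ → V} {v : V}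

theorem exists_dValid [Fintype V] [Nonempty V]
    (h : ∀ u k, k ≤ ecc G u → ∃ y, G.dist u y = k) :
    ∃ DS : List V → ℕ → V, DValid G DS := by
  choose! f hf using h
  refine ⟨fun l k => (l.head?.map fun u => f u k).getD (Classical.arbitrary V), ?_⟩
  intro l u hu k _ hk
  simpa [hu] using hf u k hk

theorem play_mono : Monotone fun n => {x | x ∈ play ES DS v n} :=
  monotone_nat_of_le_succ fun _ _ hx => List.mem_cons_of_mem _ hx

theorem exists_play_stable [Finite V] (ES : List V → ℕ) (DS : List V → ℕ → V) (v : V) :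
    ∃ N, ∀ n x, x ∈ play ES DS v n → x ∈ play ES DS v N := by
  have (x : V) : ∃ m, ∀ n, x ∈ play ES DS v n → x ∈ play ES DS v m := by
    by_cases h : ∃ m, x ∈ play ES DS v m
    · exact ⟨h.choose, fun _ _ => h.choose_spec⟩
    · exact ⟨0, fun n hn => (h ⟨n, hn⟩).elim⟩
  choose m hm using this
  obtain ⟨N, hN⟩ := (Set.finite_range m).bddAbove
  exact ⟨N, fun n x hx => play_mono (hN ⟨x, rfl⟩) (hm x n hx)⟩

theorem play_succ_of_head [Fintype V] (hE : EValid G ES) (hD : DValid G DS)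
    {n : ℕ} {u : V} (hu : (play ES DS v n).head? = some u) (he : 1 ≤ ecc G u) :
    ∃ y, play ES DS v (n + 1) = y :: play ES DS v n ∧
      G.dist u y = ES (play ES DS v n) :=
  ⟨_, rfl, hD _ u hu _ (hE _ u hu he).1 (hE _ u hu he).2⟩

theorem fd_le_card [Fintype V] [Nonempty V]
    (h : ∃ DS : List V → ℕ → V, DValid G DS) {r : ℕ}
    (hr : r ∈ {r : ℕ | ∃ ES : List V → ℕ, EValid G ES ∧
      r = sInf {s : ℕ | ∃ DS : List V → ℕ → V, DValid G DS ∧ s = playScore ES DS v}}) :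
    r ≤ Fintype.card V := by
  obtain ⟨ES, -, rfl⟩ := hr
  obtain ⟨DS, hD⟩ := h
  have hle : sInf {s : ℕ | ∃ DS : List V → ℕ → V, DValid G DS ∧ s = playScore ES DS v} ≤
      playScore ES DS v := Nat.sInf_le ⟨DS, hD, rfl⟩
  refine hle.trans ?_
  rw [← Nat.card_eq_fintype_card]
  exact Set.ncard_le_card _

theorem fd_eq_card [Fintype V] [Nonempty V]
    (h : ∃ DS : List V → ℕ → V, DValid G DS) (hE : EValid G ES)
    (hw : ∀ DS, DValid G DS → ∀ x, ∃ n, x ∈ play ES DS v n) :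
    fd G v = Fintype.card V := by
  refine le_antisymm (csSup_le' fun r hr => fd_le_card h hr)
    (le_csSup ⟨_, fun r hr => fd_le_card h hr⟩ ⟨ES, hE, ?_⟩)
  have : {s | ∃ DS : List V → ℕ → V, DValid G DS ∧ s = playScore ES DS v} =
      {Fintype.card V} := by
    have hs (DS) (hD : DValid G DS) : playScore ES DS v = Fintype.card V := by
      rw [playScore, Set.eq_univ_of_forall (s := {x | ∃ n, x ∈ play ES DS v n}) (hw DS hD),
        Set.ncard_univ, Nat.card_eq_fintype_card]
    ext s
    constructor
    · rintro ⟨DS, hD, rfl⟩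
      exact hs DS hD
    · rintro rfl
      obtain ⟨DS, hD⟩ := h
      exact ⟨DS, hD, (hs DS hD).symm⟩
  rw [this, csInf_singleton]

end Games

/-- A function satisfying the local rules of the distance to `u` is that distance. -/
theorem SimpleGraph.dist_eq_of_local {G : SimpleGraph V} {u : V} {f : V → ℕ}
    (h0 : ∀ v, f v = 0 ↔ v = u) (hle : ∀ v w, G.Adj v w → f w ≤ f v + 1)
    (hpred : ∀ v, v ≠ u → ∃ w, G.Adj w v ∧ f v = f w + 1) (v : V) : G.dist u v = f v := by
  have hup (n : ℕ) : ∀ v, f v = n → ∃ p : G.Walk u v, p.length = n := by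
    induction n with
    | zero =>
      intro v hv
      obtain rfl := (h0 v).1 hv
      exact ⟨.nil, rfl⟩
    | succ n ih =>
      intro v hv
      obtain ⟨w, hw, hf⟩ := hpred v (fun h => by simp [(h0 v).2 h] at hv)
      obtain ⟨p, hp⟩ := ih w (by omega)
      exact ⟨p.concat hw, by simp [hp]⟩
  have hlow : ∀ {a b : V} (p : G.Walk a b), f b ≤ f a + p.length := by
    intro a b p
    induction p with
    | nil => simp
    | cons h p ih =>
      have := hle _ _ h
      simp only [SimpleGraph.Walk.length_cons]
      omega
  obtain ⟨p, hp⟩ := hup _ v rfl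
  refine le_antisymm (hp ▸ G.dist_le p) ?_
  obtain ⟨q, hq⟩ := p.reachable.exists_walk_length_eq_dist
  have := hlow q
  rw [(h0 u).2 rfl] at this
  omega

/-- The distance function of the spider. -/
def spiderDist (u v : Fin 15) : ℕ :=
  if u.val < 10 then
    if v.val < 10 then (u - v : ℕ) + (v - u : ℕ) else (u - 4 : ℕ) + (4 - u : ℕ) + (v - 9 : ℕ)
  else
    if v.val < 10 then (v - 4 : ℕ) + (4 - v : ℕ) + (u - 9 : ℕ) else (u - v : ℕ) + (v - u : ℕ)

theorem spider_adj (u v : Fin 15) : spider.Adj u v ↔ spiderDist u v = 1 := by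
  rw [spider, SimpleGraph.fromRel_adj]
  revert u v
  decide +kernel

theorem spider_dist (u v : Fin 15) : spider.dist u v = spiderDist u v := by
  refine SimpleGraph.dist_eq_of_local ?_ ?_ ?_ v
  · revert u; decide +kernel
  · simp only [spider_adj]
    revert u; decide +kernel
  · simp only [spider_adj]
    revert u; decide +kernel

/-- The eccentricity function of the spider. -/
def spiderEcc (u : Fin 15) : ℕ :=
  if u.val < 4 then 9 - u else if u.val < 10 then u + 1 else u - 4

theorem ecc_spider (u : Fin 15) : ecc spider u = spiderEcc u := by
  simp only [ecc, spider_dist]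
  revert u
  decide +kernel

theorem graphDiam_spider : graphDiam spider = 10 := by
  simp only [graphDiam, ecc_spider]
  decide +kernel

theorem exists_spider_dist_eq (u : Fin 15) (k : ℕ) (hk : k ≤ ecc spider u) :
    ∃ y, spider.dist u y = k := by
  simp only [ecc_spider, spider_dist] at *
  have hb : ∀ u : Fin 15, spiderEcc u < 11 := by decide +kernel
  have key : ∀ u : Fin 15, ∀ k < 11, k ≤ spiderEcc u → ∃ y, spiderDist u y = k := by
    decide +kernel
  exact key u k (hk.trans_lt (hb u)) hk

/-- A winning Explorer strategy on the spider: first sweep the short leg, then, at the tip of a long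
leg, call the distance to an unvisited vertex of that leg; otherwise call the eccentricity. -/
def spiderExplorer (h : List (Fin 15)) : ℕ :=
  match h.head? with
  | none => 0
  | some u =>
    if u = 0 then if 1 ∉ h then 1 else if 2 ∉ h then 2 else 9
    else if u = 1 then if 2 ∉ h then 1 else if 3 ∉ h then 2 else 8
    else if u = 2 then if 3 ∉ h then 1 else 7
    else if u = 9 then
      if 8 ∉ h then 1 else if 7 ∉ h then 2 else if 6 ∉ h then 3 else
      if 5 ∉ h then 4 else if 4 ∉ h then 5 else 10
    else if u = 14 then
      if 13 ∉ h then 1 else if 12 ∉ h then 2 else if 11 ∉ h then 3 else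
      if 10 ∉ h then 4 else if 4 ∉ h then 5 else 10
    else spiderEcc u

theorem one_le_spiderEcc (u : Fin 15) : 1 ≤ spiderEcc u := by
  revert u; decide

theorem spiderExplorer_valid : EValid spider spiderExplorer := by
  intro h u hu _
  have hpos := one_le_spiderEcc u
  have h0 : u = 0 → spiderEcc u = 9 := by rintro rfl; rfl
  have h1 : u = 1 → spiderEcc u = 8 := by rintro rfl; rfl
  have h2 : u = 2 → spiderEcc u = 7 := by rintro rfl; rfl
  have h9 : u = 9 → spiderEcc u = 10 := by rintro rfl; rfl
  have h14 : u = 14 → spiderEcc u = 10 := by rintro rfl; rfl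
  rw [ecc_spider]
  simp only [spiderExplorer, hu]
  generalize spiderEcc u = e at *
  by_cases c0 : u = 0
  · rw [if_pos c0, h0 c0]; split_ifs <;> omega
  rw [if_neg c0]
  by_cases c1 : u = 1
  · rw [if_pos c1, h1 c1]; split_ifs <;> omega
  rw [if_neg c1]
  by_cases c2 : u = 2
  · rw [if_pos c2, h2 c2]; split_ifs <;> omega
  rw [if_neg c2]
  by_cases c9 : u = 9
  · rw [if_pos c9, h9 c9]; split_ifs <;> omega
  rw [if_neg c9]
  by_cases c14 : u = 14
  · rw [if_pos c14, h14 c14]; split_ifs <;> omega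
  rw [if_neg c14]
  exact ⟨hpos, le_rfl⟩

theorem one_le_ecc_spider (u : Fin 15) : 1 ≤ ecc spider u :=
  ecc_spider u ▸ one_le_spiderEcc u

section SpiderPlay

variable {DS : List (Fin 15) → ℕ → Fin 15}

theorem spider_play_succ (hD : DValid spider DS) {n : ℕ} {u : Fin 15}
    (hu : (play spiderExplorer DS 0 n).head? = some u) :
    ∃ y, play spiderExplorer DS 0 (n + 1) = y :: play spiderExplorer DS 0 n ∧
      spiderDist u y = spiderExplorer (play spiderExplorer DS 0 n) := by
  simpa only [spider_dist] using
    play_succ_of_head spiderExplorer_valid hD hu (one_le_ecc_spider u)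

theorem exists_play_short_leg (hD : DValid spider DS) :
    ∃ n, ∀ x : Fin 15, x.val < 4 → x ∈ play spiderExplorer DS 0 n := by
  have h0 : play spiderExplorer DS 0 0 = [0] := rfl
  have step (n : ℕ) (u : Fin 15) (l : List (Fin 15))
      (h : play spiderExplorer DS 0 n = u :: l) :
      ∃ y, play spiderExplorer DS 0 (n + 1) = y :: u :: l ∧
        spiderDist u y = spiderExplorer (u :: l) := by
    simpa only [h] using spider_play_succ hD (n := n) (u := u) (by rw [h]; rfl)
  obtain ⟨y, h1, e1⟩ := step _ _ _ h0
  obtain rfl : y = 1 := by clear h1; revert y; decide +kernel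
  obtain ⟨y, h2, e2⟩ := step _ _ _ h1
  obtain rfl | rfl : y = 0 ∨ y = 2 := by clear h2; revert y; decide +kernel
  · obtain ⟨y, h3, e3⟩ := step _ _ _ h2
    obtain rfl : y = 2 := by clear h3; revert y; decide +kernel
    obtain ⟨y, h4, e4⟩ := step _ _ _ h3
    obtain rfl | rfl : y = 1 ∨ y = 3 := by clear h4; revert y; decide +kernel
    · obtain ⟨y, h5, e5⟩ := step _ _ _ h4
      obtain rfl : y = 3 := by clear h5; revert y; decide +kernel
      exact ⟨_, by rw [h5]; decide⟩
    · exact ⟨_, by rw [h4]; decide⟩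
  · obtain ⟨y, h3, e3⟩ := step _ _ _ h2
    obtain rfl | rfl : y = 1 ∨ y = 3 := by clear h3; revert y; decide +kernel
    · obtain ⟨y, h4, e4⟩ := step _ _ _ h3
      obtain rfl : y = 3 := by clear h4; revert y; decide +kernel
      exact ⟨_, by rw [h4]; decide⟩
    · exact ⟨_, by rw [h3]; decide⟩

theorem eq_tip_of_spiderDist (u y : Fin 15) (h9 : u ≠ 9) (h14 : u ≠ 14)
    (h : spiderDist u y = spiderEcc u) : y = 9 ∨ y = 14 := by
  revert u y; decide +kernel

theorem spiderExplorer_eq_ecc {h : List (Fin 15)} {u : Fin 15} (hu : h.head? = some u)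
    (hs : ∀ x : Fin 15, x.val < 4 → x ∈ h) (h9 : u ≠ 9) (h14 : u ≠ 14) :
    spiderExplorer h = spiderEcc u := by
  have hh1 := hs 1 (by decide)
  have hh2 := hs 2 (by decide)
  have hh3 := hs 3 (by decide)
  fin_cases u <;> simp_all [spiderExplorer, spiderEcc]

theorem mem_of_head_nine {h : List (Fin 15)} {y : Fin 15} (hu : h.head? = some 9)
    (hd : spiderDist 9 y = spiderExplorer h) (hy : y ∈ h) :
    (∀ x : Fin 15, 4 ≤ x.val ∧ x.val < 10 → x ∈ h) ∧ y = 14 := by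
  have hh9 := List.mem_of_mem_head? hu
  simp only [spiderExplorer, hu] at hd
  rw [if_neg (by decide), if_neg (by decide), if_neg (by decide)] at hd
  simp only [if_true] at hd
  split_ifs at hd with h8 h7 h6 h5 h4
  · refine ⟨?_, by clear hy; revert y; decide +kernel⟩
    intro x
    fin_cases x <;> first | exact fun _ => ‹_› | exact fun h => absurd h (by decide)
  · obtain rfl : y = 4 := by clear hy; revert y; decide +kernel
    exact (h4 hy).elim
  · obtain rfl : y = 5 := by clear hy; revert y; decide +kernel
    exact (h5 hy).elim
  · obtain rfl : y = 6 := by clear hy; revert y; decide +kernel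
    exact (h6 hy).elim
  · obtain rfl : y = 7 := by clear hy; revert y; decide +kernel
    exact (h7 hy).elim
  · obtain rfl : y = 8 := by clear hy; revert y; decide +kernel
    exact (h8 hy).elim

theorem mem_of_head_fourteen {h : List (Fin 15)} {y : Fin 15} (hu : h.head? = some 14)
    (hd : spiderDist 14 y = spiderExplorer h) (hy : y ∈ h) :
    (∀ x : Fin 15, 10 ≤ x.val → x ∈ h) ∧ y = 9 := by
  have hh14 := List.mem_of_mem_head? hu
  simp only [spiderExplorer, hu] at hd
  rw [if_neg (by decide), if_neg (by decide), if_neg (by decide), if_neg (by decide)] at hd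
  simp only [if_true] at hd
  split_ifs at hd with h13 h12 h11 h10 h4
  · refine ⟨?_, by clear hy; revert y; decide +kernel⟩
    intro x
    fin_cases x <;> first | exact fun _ => ‹_› | exact fun h => absurd h (by decide)
  · obtain rfl : y = 4 := by clear hy; revert y; decide +kernel
    exact (h4 hy).elim
  · obtain rfl : y = 10 := by clear hy; revert y; decide +kernel
    exact (h10 hy).elim
  · obtain rfl : y = 11 := by clear hy; revert y; decide +kernel
    exact (h11 hy).elim
  · obtain rfl : y = 12 := by clear hy; revert y; decide +kernel
    exact (h12 hy).elim
  · obtain rfl : y = 13 := by clear hy; revert y; decide +kernel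
    exact (h13 hy).elim

theorem exists_mem_play (hD : DValid spider DS) (x : Fin 15) :
    ∃ n, x ∈ play spiderExplorer DS 0 n := by
  obtain ⟨N, hN⟩ := exists_play_stable spiderExplorer DS 0
  obtain ⟨K, hK⟩ := exists_play_short_leg hD
  set P := play spiderExplorer DS 0 with hP
  have hs (m : ℕ) (hm : max N K ≤ m) (x : Fin 15) (hx : x.val < 4) : x ∈ P m :=
    play_mono ((le_max_right _ _).trans hm) (hK x hx)
  have hst (m : ℕ) (hm : max N K ≤ m) (u : Fin 15) (hu : (P m).head? = some u) :
      ∃ y, (P (m + 1)).head? = some y ∧ y ∈ P m ∧ spiderDist u y = spiderExplorer (P m) := by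
    obtain ⟨y, hy, hd⟩ := spider_play_succ hD hu
    refine ⟨y, by rw [hP, hy]; rfl, ?_, hd⟩
    exact play_mono ((le_max_left _ _).trans hm) (hN (m + 1) y (by rw [hP, hy]; simp))
  have hnine (m : ℕ) (hm : max N K ≤ m) (hu : (P m).head? = some 9) :
      (P (m + 1)).head? = some 14 ∧ ∀ x : Fin 15, 4 ≤ x.val ∧ x.val < 10 → ∃ n, x ∈ P n := by
    obtain ⟨y, hy, hmem, hd⟩ := hst m hm 9 hu
    obtain ⟨hall, rfl⟩ := mem_of_head_nine hu hd hmem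
    exact ⟨hy, fun x hx => ⟨m, hall x hx⟩⟩
  have hfourteen (m : ℕ) (hm : max N K ≤ m) (hu : (P m).head? = some 14) :
      (P (m + 1)).head? = some 9 ∧ ∀ x : Fin 15, 10 ≤ x.val → ∃ n, x ∈ P n := by
    obtain ⟨y, hy, hmem, hd⟩ := hst m hm 14 hu
    obtain ⟨hall, rfl⟩ := mem_of_head_fourteen hu hd hmem
    exact ⟨hy, fun x hx => ⟨m, hall x hx⟩⟩
  have htip : ∃ m, max N K ≤ m ∧ ((P m).head? = some 9 ∨ (P m).head? = some 14) := by
    obtain ⟨u, hu⟩ : ∃ u, (P (max N K)).head? = some u := by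
      cases h : max N K <;> exact ⟨_, rfl⟩
    by_cases h9 : u = 9
    · exact ⟨_, le_rfl, .inl (h9 ▸ hu)⟩
    by_cases h14 : u = 14
    · exact ⟨_, le_rfl, .inr (h14 ▸ hu)⟩
    obtain ⟨y, hy, -, hd⟩ := hst _ le_rfl u hu
    rw [spiderExplorer_eq_ecc hu (hs _ le_rfl) h9 h14] at hd
    refine ⟨_, Nat.le_succ _, ?_⟩
    obtain rfl | rfl := eq_tip_of_spiderDist u y h9 h14 hd
    · exact .inl hy
    · exact .inr hy
  obtain hx | hx | hx : x.val < 4 ∨ (4 ≤ x.val ∧ x.val < 10) ∨ 10 ≤ x.val := by omega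
  · exact ⟨K, hK x hx⟩
  · obtain ⟨m, hm, h | h⟩ := htip
    · exact (hnine m hm h).2 x hx
    · exact (hnine (m + 1) (hm.trans m.le_succ) (hfourteen m hm h).1).2 x hx
  · obtain ⟨m, hm, h | h⟩ := htip
    · exact (hfourteen (m + 1) (hm.trans m.le_succ) (hnine m hm h).1).2 x hx
    · exact (hfourteen m hm h).2 x hx

end SpiderPlay

section SpiderAvoids

variable {S : List ℕ}

theorem spider_avoids_of_four_le (u w : Fin 15) (hu : 4 ≤ u.val) (hw : w.val < 4)
    (hp : NAPlayable spider S u) : Avoids spider S u w := by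
  have hne (u : Fin 15) (hu : 4 ≤ u.val) : u ≠ w := by rintro rfl; omega
  induction S generalizing u with
  | nil => exact avoids_nil (hne u hu)
  | cons d S ih =>
    obtain ⟨z, rfl⟩ := hp.exists_dist_eq
    have key : ∀ u z : Fin 15, 4 ≤ u.val → ∃ y : Fin 15, 4 ≤ y.val ∧
        spiderDist u y = spiderDist u z := by decide +kernel
    obtain ⟨y, hy, hd⟩ := key u z hu
    rw [← spider_dist, ← spider_dist] at hd
    exact (ih y hy (hp.tail hd)).cons (hne u hu) hd

theorem spider_avoids_of_call {d : ℕ} (u w : Fin 15) (hu : u.val < 4) (hd : 4 ≤ u.val + d)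
    (hw : w.val < 4) (huw : u ≠ w) (hp : NAPlayable spider (d :: S) u) :
    Avoids spider (d :: S) u w := by
  obtain ⟨z, rfl⟩ := hp.exists_dist_eq
  have key : ∀ u z : Fin 15, u.val < 4 → 4 ≤ u.val + spiderDist u z →
      ∃ y : Fin 15, 4 ≤ y.val ∧ spiderDist u y = spiderDist u z := by decide +kernel
  rw [spider_dist] at hd
  obtain ⟨y, hy, hd⟩ := key u z hu hd
  rw [← spider_dist, ← spider_dist] at hd
  exact (spider_avoids_of_four_le y w hy hw (hp.tail hd)).cons huw hd

theorem spider_avoids_three_start (w : Fin 15) (hw : w.val < 3) (hS : ∀ d ∈ S, 1 ≤ d)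
    (hp : NAPlayable spider S 3) : Avoids spider S 3 w := by
  have hne : (3 : Fin 15) ≠ w := by rintro rfl; exact absurd hw (by decide)
  cases S with
  | nil => exact avoids_nil hne
  | cons d S =>
    have := hS d (by simp)
    exact spider_avoids_of_call 3 w (by decide) (by simpa using by omega) (by omega) hne hp

theorem spider_avoids_two_start (hS : ∀ d ∈ S, 1 ≤ d) (hp : NAPlayable spider S 2) :
    Avoids spider S 2 1 := by
  cases S with
  | nil => exact avoids_nil (by decide)
  | cons d S =>
    obtain rfl | hd : d = 1 ∨ 2 ≤ d := by have := hS d (by simp); omega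
    · have h3 : spider.dist 2 3 = 1 := by rw [spider_dist]; rfl
      exact (spider_avoids_three_start 1 (by decide) (fun d hd => hS d (by simp [hd]))
        (hp.tail h3)).cons (by decide) h3
    · exact spider_avoids_of_call 2 1 (by decide) (by simpa using by omega) (by decide)
        (by decide) hp

/-- As long as `1` is called, the token may be at `1`, or, having missed `3`, at either of `0` and
`2`; any other call then lets the Director escape with `2` or `3` unvisited. -/
theorem spider_avoids_alternating (hS : ∀ d ∈ S, 1 ≤ d) :
    (NAPlayable spider S 1 → Avoids spider S 1 2 ∨ Avoids spider S 1 3) ∧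
    (NAPlayable spider S 0 → NAPlayable spider S 2 →
      Avoids spider S 0 2 ∨ Avoids spider S 0 3 ∨ Avoids spider S 2 3) := by
  induction S with
  | nil => exact ⟨fun _ => .inl (avoids_nil (by decide)), fun _ _ => .inl (avoids_nil (by decide))⟩
  | cons d S ih =>
    have hS' : ∀ d ∈ S, 1 ≤ d := fun d hd => hS d (by simp [hd])
    obtain ⟨ih1, ih2⟩ := ih hS'
    have h01 : spider.dist 0 1 = 1 := by rw [spider_dist]; rfl
    have h10 : spider.dist 1 0 = 1 := by rw [spider_dist]; rfl
    have h12 : spider.dist 1 2 = 1 := by rw [spider_dist]; rfl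
    have h13 : spider.dist 1 3 = 2 := by rw [spider_dist]; rfl
    constructor
    · intro hp
      obtain rfl | rfl | hd : d = 1 ∨ d = 2 ∨ 3 ≤ d := by have := hS d (by simp); omega
      · obtain h | h | h := ih2 (hp.tail h10) (hp.tail h12)
        · exact .inl (h.cons (by decide) h10)
        · exact .inr (h.cons (by decide) h10)
        · exact .inr (h.cons (by decide) h12)
      · exact .inl ((spider_avoids_three_start 2 (by decide) hS' (hp.tail h13)).cons
          (by decide) h13)
      · exact .inl (spider_avoids_of_call 1 2 (by decide) (by simpa using by omega) (by decide)
          (by decide) hp)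
    · intro hp0 hp2
      obtain rfl | hd : d = 1 ∨ 2 ≤ d := by have := hS d (by simp); omega
      · obtain h | h := ih1 (hp0.tail h01)
        · exact .inl (h.cons (by decide) h01)
        · exact .inr (.inl (h.cons (by decide) h01))
      · exact .inr (.inr (spider_avoids_of_call 2 3 (by decide) (by simpa using by omega)
          (by decide) (by decide) hp2))

theorem exists_spider_avoids (hS : ∀ d ∈ S, 1 ≤ d) (hp : NAPlayable spider S 0) :
    ∃ w, Avoids spider S 0 w := by
  cases S with
  | nil => exact ⟨1, avoids_nil (by decide)⟩
  | cons d S =>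
    have hS' : ∀ d ∈ S, 1 ≤ d := fun d hd => hS d (by simp [hd])
    have h01 : spider.dist 0 1 = 1 := by rw [spider_dist]; rfl
    have h02 : spider.dist 0 2 = 2 := by rw [spider_dist]; rfl
    have h03 : spider.dist 0 3 = 3 := by rw [spider_dist]; rfl
    obtain rfl | rfl | rfl | hd : d = 1 ∨ d = 2 ∨ d = 3 ∨ 4 ≤ d := by
      have := hS d (by simp); omega
    · obtain h | h := (spider_avoids_alternating hS').1 (hp.tail h01)
      · exact ⟨2, h.cons (by decide) h01⟩
      · exact ⟨3, h.cons (by decide) h01⟩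
    · exact ⟨1, (spider_avoids_two_start hS' (hp.tail h02)).cons (by decide) h02⟩
    · exact ⟨1, (spider_avoids_three_start 1 (by decide) hS' (hp.tail h03)).cons (by decide) h03⟩
    · exact ⟨1, spider_avoids_of_call 0 1 (by decide) (by simpa using hd) (by decide)
        (by decide) hp⟩

end SpiderAvoids

/-- The spider tree `T` (15 vertices, diameter 10) has `f_d(T, a) = 15`,
yet there is no playable nonadaptive strategy achieving this score: the game on `T`
started at `a` admits no optimal nonadaptive strategy. -/
theorem stmt_15 :
    graphDiam spider = 10 ∧ fd spider (0 : Fin 15) = 15 ∧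
      ¬ ∃ S : List ℕ, (∀ d ∈ S, 1 ≤ d) ∧ NAPlayable spider S (0 : Fin 15) ∧
        naScore spider S (0 : Fin 15) = fd spider (0 : Fin 15) := by
  have hfd : fd spider (0 : Fin 15) = 15 :=
    fd_eq_card (exists_dValid exists_spider_dist_eq) spiderExplorer_valid
      fun _ hD => exists_mem_play hD
  refine ⟨graphDiam_spider, hfd, ?_⟩
  rintro ⟨S, hS, hp, hscore⟩
  obtain ⟨w, hw⟩ := exists_spider_avoids hS hp
  exact absurd (hscore.trans hfd) hw.naScore_lt.ne
end

section
/- Let G be a finite connected simple graph, let U be a closed set of vertices of G, and let u ∈ U. Then the cardinality of U is at least ecc(u) + 1, where ecc(u) is the eccentricity of u. -/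
open SimpleGraph

variable {V : Type*}

/-- In a connected graph, every distance up to `G.dist u w` is attained from `u`. -/
lemma SimpleGraph.Connected.exists_dist_eq {V : Type*} {G : SimpleGraph V} (hc : G.Connected)
    {u w : V} {k : ℕ} (hk : k ≤ G.dist u w) : ∃ v, G.dist u v = k := by
  obtain ⟨p, hp⟩ := hc.exists_walk_length_eq_dist u w
  refine ⟨p.getVert k, ?_⟩
  have h₁ := dist_le (p.take k)
  have h₂ := dist_le (p.drop k)
  have h₃ : G.dist u w ≤ G.dist u (p.getVert k) + G.dist (p.getVert k) w := hc.dist_triangle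
  rw [Walk.take_length] at h₁
  rw [Walk.drop_length] at h₂
  omega

/-- A closed set `U` of a finite connected simple graph containing a vertex
`u` has cardinality at least `ecc(u) + 1`. -/
theorem stmt_16 {V : Type*} [Fintype V] (G : SimpleGraph V) (hc : G.Connected)
    (U : Set V) (hU : IsClosedSet G U) (u : V) (hu : u ∈ U) :
    ecc G u + 1 ≤ U.ncard := by
  obtain ⟨w, -, hw⟩ := Finset.exists_mem_eq_sup Finset.univ ⟨u, Finset.mem_univ u⟩
    fun w => G.dist u w
  have hsub : (Finset.range (ecc G u + 1) : Set ℕ) ⊆ G.dist u '' U := by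
    intro k hk
    have hk' : k ≤ G.dist u w :=
      (Nat.lt_succ_iff.mp (Finset.mem_range.mp (Finset.mem_coe.mp hk))).trans hw.le
    obtain ⟨v, hv⟩ := hc.exists_dist_eq hk'
    obtain ⟨x, hx, hvx⟩ := hU.2 u hu v
    exact ⟨x, hx, hvx.symm.trans hv⟩
  calc ecc G u + 1 = (Finset.range (ecc G u + 1) : Set ℕ).ncard := by
        rw [Set.ncard_coe_finset, Finset.card_range]
    _ ≤ (G.dist u '' U).ncard := Set.ncard_le_ncard hsub (U.toFinite.image _)
    _ ≤ U.ncard := Set.ncard_image_le U.toFinite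
end

section
/- Let T be a tree and let P be a path in T whose length equals diam(T) (so P has diam(T) + 1 vertices, and its endpoints are at graph distance diam(T)). Then the vertex set of P is a closed set of T. -/
open SimpleGraph

variable {V : Type*}

theorem SimpleGraph.IsAcyclic.length_eq_dist {V : Type*} {G : SimpleGraph V} (ha : G.IsAcyclic)
    {u v : V} {p : G.Walk u v} (hp : p.IsPath) : p.length = G.dist u v := by
  obtain ⟨q, hq, hlen⟩ := Reachable.exists_path_of_dist ⟨p⟩
  have hpq : p = q :=
    congrArg Subtype.val ((ha.subsingleton_path u v).elim ⟨p, hp⟩ ⟨q, hq⟩)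
  rw [hpq, hlen]

/-- In a forest, a path leaving a vertex of another path avoids retracing at least one of the two
directions along that path. -/
theorem SimpleGraph.IsAcyclic.isPath_append_or_isPath_reverse_append {V : Type*}
    {G : SimpleGraph V} (ha : G.IsAcyclic) {a b u v : V} {q : G.Walk a u} {r : G.Walk u b}
    (hqr : (q.append r).IsPath) {p : G.Walk u v} (hp : p.IsPath) :
    (q.append p).IsPath ∨ (r.reverse.append p).IsPath := by
  have hr := (Walk.isPath_reverse_iff r).2 hqr.of_append_right
  simp only [ha.isPath_iff_isChain, Walk.edges_append, List.isChain_append] at hqr hp hr ⊢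
  by_contra! h
  obtain ⟨e, he, f, hf, rfl⟩ := h.1 hqr.1 hp
  obtain ⟨e', he', f', hf', rfl⟩ := h.2 hr hp
  obtain rfl : e = e' := Option.some_injective _ (hf.symm.trans hf')
  rw [Walk.edges_reverse, List.getLast?_reverse] at he'
  exact hqr.2.2 e he e he' rfl

theorem dist_le_graphDiam {V : Type*} [Fintype V] (G : SimpleGraph V) (u v : V) :
    G.dist u v ≤ graphDiam G :=
  (Finset.le_sup (f := fun w => G.dist u w) (Finset.mem_univ v)).trans
    (Finset.le_sup (f := fun w => ecc G w) (Finset.mem_univ u))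

/-- Along a path in a forest every distance up to its length is realised from its start. -/
theorem SimpleGraph.IsAcyclic.exists_mem_support_dist_eq {V : Type*} {G : SimpleGraph V}
    (ha : G.IsAcyclic) {u v : V} {p : G.Walk u v} (hp : p.IsPath) {n : ℕ} (hn : n ≤ p.length) :
    ∃ x ∈ p.support, G.dist u x = n := by
  refine ⟨p.getVert n, p.getVert_mem_support n, ?_⟩
  rw [← ha.length_eq_dist (hp.take n), Walk.take_length, min_eq_left hn]

/-- In a tree `T`, the vertex set of any path whose length equals `diam T`
is a closed set of `T`. -/
theorem stmt_17 {V : Type*} [Fintype V] (G : SimpleGraph V)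
    (hc : G.Connected) (ha : G.IsAcyclic) {a b : V}
    (P : G.Walk a b) (hP : P.IsPath) (hlen : P.length = graphDiam G) :
    IsClosedSet G {x : V | x ∈ P.support} := by
  refine ⟨⟨a, P.start_mem_support⟩, fun u hu v => ?_⟩
  obtain ⟨q, r, hq, hr, rfl⟩ := hP.mem_support_iff_exists_append.1 hu
  obtain ⟨p, hp, hpd⟩ := hc.exists_path_of_dist u v
  rw [Walk.length_append] at hlen
  rcases ha.isPath_append_or_isPath_reverse_append hP hp with h | h
  · have hle := ha.length_eq_dist h ▸ dist_le_graphDiam G a v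
    rw [Walk.length_append] at hle
    obtain ⟨x, hx, hd⟩ := ha.exists_mem_support_dist_eq hr (n := p.length) (by omega)
    exact ⟨x, Walk.support_subset_support_append_right q r hx, (hd.trans hpd).symm⟩
  · have hle := ha.length_eq_dist h ▸ dist_le_graphDiam G b v
    rw [Walk.length_append, Walk.length_reverse] at hle
    obtain ⟨x, hx, hd⟩ := ha.exists_mem_support_dist_eq
      ((Walk.isPath_reverse_iff q).2 hq) (n := p.length) (by rw [Walk.length_reverse]; omega)
    rw [Walk.support_reverse, List.mem_reverse] at hx
    exact ⟨x, Walk.support_subset_support_append_left q r hx, (hd.trans hpd).symm⟩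
end
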